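/- Every graph on which a group G of automorphisms acts with finitely many vertex orbits, and which is connected, admits a fundamental transversal: a set S of vertices intersecting each G-orbit in exactly one vertex such that the induced subgraph on S is connected. -/

import Mathlib

theorem exists_fundamental_transversal {V : Type*} (Γ : SimpleGraph V)
    (G : Type*) [Group G] [MulAction G V]
    (hact : ∀ (g : G) (u v : V), Γ.Adj (g • u) (g • v) ↔ Γ.Adj u v)
    (hconn : Γ.Connected)
    (horb : Finite (MulAction.orbitRel.Quotient G V)) :
    ∃ S : Set V,
      (∀ v : V, ∃! s : V, s ∈ S ∧ s ∈ MulAction.orbit G v) ∧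
      (Γ.induce S).Connected := by
  let q : V → MulAction.orbitRel.Quotient G V := fun v => Quotient.mk _ v
  have hq : ∀ u v, q u = q v ↔ u ∈ MulAction.orbit G v := fun u v => by
    rw [← MulAction.orbitRel_apply]; exact Quotient.eq
  let P : Set (Set (MulAction.orbitRel.Quotient G V)) :=
    {T | ∃ S : Set V, Set.InjOn q S ∧ q '' S = T ∧ (Γ.induce S).Connected}
  obtain ⟨v0⟩ := hconn.nonempty
  have hne : P.Nonempty := by
    refine ⟨_, {v0}, by simp, rfl, ?_⟩
    simp
  obtain ⟨T, hT⟩ := (Set.toFinite P).exists_maximal hne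
  obtain ⟨S, hinj, hST, hS⟩ := hT.prop
  have hall : ∀ v, q v ∈ T := by
    obtain ⟨s, hs⟩ := hS.nonempty
    intro v
    have hr := (SimpleGraph.reachable_iff_reflTransGen s v).1 (hconn.preconnected s v)
    induction hr with
    | refl => rw [← hST]; exact ⟨s, hs, rfl⟩
    | @tail x y _ hxy ih =>
      by_contra hy
      rw [← hST] at ih
      obtain ⟨w, hw, hx⟩ := ih
      obtain ⟨g, hg⟩ := (hq _ _).1 hx
      have hadj : Γ.Adj w (g • y) := by
        rw [← hg]; exact (hact g x y).2 hxy
      have hqy : q (g • y) = q y := (hq _ _).2 ⟨g, rfl⟩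
      have hmem : insert (q y) T ∈ P := by
        refine ⟨insert (g • y) S, ?_, ?_, ?_⟩
        · have hn : g • y ∉ S := fun h => hy (by rw [← hST, ← hqy]; exact ⟨_, h, rfl⟩)
          rw [Set.injOn_insert hn]
          exact ⟨hinj, by rw [hqy, hST]; exact hy⟩
        · rw [Set.image_insert_eq, hqy, hST]
        · have h1 : (Γ.induce ({g • y} : Set V)).Connected := by simp
          have := SimpleGraph.connected_induce_union h1.preconnected hS.preconnected
            (Set.mem_singleton (g • y)) hw hadj.symm
          rwa [Set.singleton_union] at this
      exact hy (hT.le_of_ge hmem (Set.subset_insert _ _) (Set.mem_insert _ _))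
  refine ⟨S, fun v => ?_, hS⟩
  have := hall v
  rw [← hST] at this
  obtain ⟨s, hs, hsv⟩ := this
  exact ⟨s, ⟨hs, (hq _ _).1 hsv⟩, fun t ht => hinj ht.1 hs (((hq _ _).2 ht.2).trans hsv.symm)⟩
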